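/- Let n be a positive integer with n ≡ 1 (mod 4). Then Σ_{k=0}^{(n−1)/2} [6k−1]_q · (q^{−1}; q^4)_k (q^{−1}; q²)_k (q; q²)_k² / ((q²; q²)_k (q^4; q^4)_k (q²; q^4)_k²) · q^{k²+k+1} ≡ − (q²; q^4)_{(n−1)/4} / (q^4; q^4)_{(n−1)/4} · q^{(n−1)/4} (mod Φ_n(q)^3). -/

import Mathlib

open Finset

noncomputable section

abbrev R1 : Type := Polynomial ℚ
abbrev K1 : Type := FractionRing R1

/-- The variable `q` as a rational function in `ℚ(q)`. -/
def qv : K1 := algebraMap R1 K1 Polynomial.X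

/-- The q-shifted factorial `(a; q)_k = (1-a)(1-aq)⋯(1-aq^{k-1})`. -/
def qPoch {R : Type*} [CommRing R] (a q : R) (k : ℕ) : R :=
  ∏ j ∈ Finset.range k, (1 - a * q ^ j)

/-- The q-integer `[m]_q = (1 - q^m)/(1 - q)`. -/
def qInt {K : Type*} [Field K] (q : K) (m : ℤ) : K := (1 - q ^ m) / (1 - q)

/-- `A ≡ B (mod M)`: the polynomial `M` divides the numerator of the reduced form
of the rational function `A - B`. -/
def CongrMod1 (A B : K1) (M : R1) : Prop :=
  ∃ f g : R1, g ≠ 0 ∧ (∀ p : R1, Prime p → p ∣ g → ¬ p ∣ M) ∧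
    (A - B) * algebraMap R1 K1 g = algebraMap R1 K1 M * algebraMap R1 K1 f

/-- Numerator of the ratio of consecutive summands, deformed by `y = a + a⁻¹ - 2`:
`(q;q²)_k²` is replaced by `(aq, q/a; q²)_k`. -/
def stepNum {R : Type*} [CommRing R] (q y : R) (j : ℕ) : R :=
  (q - q ^ (2 * j)) * (q - q ^ (4 * j)) * q ^ (2 * j) *
    ((1 - q ^ (2 * j + 1)) ^ 2 - q ^ (2 * j + 1) * y)

/-- Denominator of the ratio of consecutive summands, deformed by `y = a + a⁻¹ - 2`:
`(q²;q⁴)_k²` is replaced by `(aq², q²/a; q⁴)_k`. -/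
def stepDen {R : Type*} [CommRing R] (q y : R) (j : ℕ) : R :=
  (1 - q ^ (2 * j + 2)) * (1 - q ^ (4 * j + 4)) *
    ((1 - q ^ (4 * j + 2)) ^ 2 - q ^ (4 * j + 2) * y)

section TermProd
variable {L : Type*} [Field L]

/-- The hypergeometric part of the deformed summand. -/
def termProd (q y : L) (k : ℕ) : L := ∏ j ∈ range k, stepNum q y j / stepDen q y j

lemma termProd_succ (q y : L) (k : ℕ) :
    termProd q y (k + 1) = termProd q y k * (stepNum q y k / stepDen q y k) := prod_range_succ _ _

lemma stepNum_mul (q y c : L) (h : c * (y + 2) = c ^ 2 + 1) (j : ℕ) :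
    c * stepNum q y j = (q - q ^ (2 * j)) * (q - q ^ (4 * j)) * q ^ (2 * j) *
      ((c - q ^ (2 * j + 1)) * (1 - c * q ^ (2 * j + 1))) := by
  unfold stepNum
  linear_combination (-(q - q ^ (2 * j)) * (q - q ^ (4 * j)) * q ^ (2 * j) * q ^ (2 * j + 1)) * h

lemma stepDen_mul (q y c : L) (h : c * (y + 2) = c ^ 2 + 1) (j : ℕ) :
    c * stepDen q y j = (1 - q ^ (2 * j + 2)) * (1 - q ^ (4 * j + 4)) *
      ((c - q ^ (4 * j + 2)) * (1 - c * q ^ (4 * j + 2))) := by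
  unfold stepDen
  linear_combination (-(1 - q ^ (2 * j + 2)) * (1 - q ^ (4 * j + 4)) * q ^ (4 * j + 2)) * h

lemma termProd_succ_mul (q y : L) (k : ℕ) (h : stepDen q y k ≠ 0) :
    termProd q y (k + 1) * stepDen q y k = termProd q y k * stepNum q y k := by
  rw [termProd_succ, mul_assoc, div_mul_cancel₀ _ h]

lemma shift_step {u u' v v' N D N' D' P Q P' Q' : L} (hu : u' * D = u * N)
    (hv : v' * D' = v * N') (ih : u * P = Q * v) (hD : D ≠ 0) (hD' : D' ≠ 0) (hP : P ≠ 0)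
    (key : Q * N * P' * D' = Q' * N' * D * P) : u' * P' = Q' * v' := by
  apply mul_left_cancel₀ (mul_ne_zero (mul_ne_zero hD hD') hP)
  linear_combination (P' * D' * P) * hu + (N * P' * D') * ih - (Q' * D * P) * hv + v * key

lemma telescope_step {u v v' N' D' Q e h h' g g' α β : L}
    (hv : v' * D' = v * N') (sh : u * (h * e) = Q * v) (hD' : D' ≠ 0) (hh : h ≠ 0) (he : e ≠ 0)
    (hh' : h' ≠ 0) (key : (g * e + (α * Q - β * h * e)) * D' * h' = N' * g' * h * e) :
    v * g / h + (α * u - β * v) = v' * g' / h' := by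
  rw [eq_div_of_mul_eq (mul_ne_zero hh he) sh, eq_div_of_mul_eq hD' hv]
  field_simp
  linear_combination v * key

lemma termProd_shift (q y y' c : L) (hq : q ≠ 0) (hc : c ≠ 0) (h : c * (y + 2) = c ^ 2 + 1)
    (h' : (c * q ^ 4) * (y' + 2) = (c * q ^ 4) ^ 2 + 1)
    (hd : ∀ j, stepDen q y j ≠ 0) (hd' : ∀ j, stepDen q y' j ≠ 0)
    (h2 : ∀ j : ℕ, 1 - c * q ^ j ≠ 0)
    (h3 : ∀ j : ℕ, c * q ^ 2 - q ^ (4 * j) ≠ 0) (k : ℕ) :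
    termProd q y k * ((1 - c * q ^ (2 * k + 1)) * ((1 - c * q ^ (2 * k + 3)) *
      (c * q ^ 2 - q ^ (4 * k)))) =
    -((c * q ^ 3 - q ^ (2 * k)) * (c * q - q ^ (2 * k)) * (1 - c * q ^ (4 * k + 2))) *
      termProd q y' k := by
  induction k with
  | zero => simp [termProd]; ring
  | succ k ih =>
    have hcq : c * q ^ 4 ≠ 0 := mul_ne_zero hc (pow_ne_zero _ hq)
    have hu := termProd_succ_mul q y k (hd k)
    have hv := termProd_succ_mul q y' k (hd' k)
    replace hu : termProd q y (k + 1) * (c * stepDen q y k) =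
      termProd q y k * (c * stepNum q y k) := by linear_combination c * hu
    replace hv : termProd q y' (k + 1) * (c * q ^ 4 * stepDen q y' k) =
      termProd q y' k * (c * q ^ 4 * stepNum q y' k) := by linear_combination c * q ^ 4 * hv
    refine shift_step hu hv ih (mul_ne_zero hc (hd k)) (mul_ne_zero hcq (hd' k))
      (mul_ne_zero (h2 _) (mul_ne_zero (h2 _) (h3 _))) ?_
    rw [stepNum_mul q y c h, stepNum_mul q y' _ h', stepDen_mul q y c h, stepDen_mul q y' _ h']
    generalize (q - q ^ (2 * k)) * (q - q ^ (4 * k)) * q ^ (2 * k) = E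
    generalize (1 - q ^ (2 * k + 2)) * (1 - q ^ (4 * k + 4)) = F
    have e2 : q ^ (4 * k) = (q ^ (2 * k)) ^ 2 := by ring
    simp only [mul_add, mul_one, pow_add, e2]
    generalize q ^ (2 * k) = x
    ring

/-- Telescoping relation between the deformed sums at the parameters `a = c` and `a = c q⁴`. -/
lemma sum_shift (q y y' c : L) (hq : q ≠ 0) (hc : c ≠ 0) (h : c * (y + 2) = c ^ 2 + 1)
    (h' : (c * q ^ 4) * (y' + 2) = (c * q ^ 4) ^ 2 + 1)
    (hd : ∀ j, stepDen q y j ≠ 0) (hd' : ∀ j, stepDen q y' j ≠ 0)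
    (h2 : ∀ j : ℕ, 1 - c * q ^ j ≠ 0)
    (h3 : ∀ j : ℕ, c * q ^ 2 - q ^ (4 * j) ≠ 0) (K : ℕ) :
    ∑ k ∈ range K, ((q - q ^ (6 * k)) * (q * (1 - q * c)) * termProd q y k -
      (q - q ^ (6 * k)) * (1 - c * q ^ 3) * termProd q y' k) =
    termProd q y' K * (q * (1 - q ^ (4 * K)) * (1 - c * q ^ (4 * K + 2)) * (1 - q ^ (2 * K)) *
      (1 - c ^ 2 * q ^ 4)) / ((1 - c * q ^ (2 * K + 1)) * (1 - c * q ^ (2 * K + 3))) := by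
  induction K with
  | zero => simp
  | succ k ih =>
    have hcq : c * q ^ 4 ≠ 0 := mul_ne_zero hc (pow_ne_zero _ hq)
    have hv := termProd_succ_mul q y' k (hd' k)
    replace hv : termProd q y' (k + 1) * (c * q ^ 4 * stepDen q y' k) =
      termProd q y' k * (c * q ^ 4 * stepNum q y' k) := by linear_combination c * q ^ 4 * hv
    have sh := termProd_shift q y y' c hq hc h h' hd hd' h2 h3 k
    rw [← mul_assoc (1 - c * q ^ (2 * k + 1))] at sh
    rw [sum_range_succ, ih]
    refine telescope_step hv sh (mul_ne_zero hcq (hd' k)) (mul_ne_zero (h2 _) (h2 _)) (h3 _)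
      (mul_ne_zero (h2 _) (h2 _)) ?_
    rw [stepNum_mul q y' _ h', stepDen_mul q y' _ h']
    have e2 : q ^ (4 * k) = (q ^ (2 * k)) ^ 2 := by ring
    have e3 : q ^ (6 * k) = (q ^ (2 * k)) ^ 3 := by ring
    simp only [mul_add, mul_one, pow_add, e2, e3]
    generalize q ^ (2 * k) = x
    ring

/-- Numerator of the ratio of consecutive terms when the parameter `q⁻¹` of `(q⁻¹;q²)_k`
is replaced by `A`. -/
def baseNum (q A y : L) (j : ℕ) : L :=
  (1 - A * q ^ (2 * j)) * ((q - q ^ (4 * j)) * (A * q ^ (2 * j + 2)) *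
    ((1 - q ^ (2 * j + 1)) ^ 2 - q ^ (2 * j + 1) * y))

/-- Denominator of the ratio of consecutive terms for a general base parameter `A`. -/
def baseDen (q A y : L) (j : ℕ) : L :=
  (1 - q ^ (4 * j + 4)) * ((1 - A * q ^ (2 * j + 3)) *
    ((1 - A * q ^ (4 * j + 3)) ^ 2 - A * q ^ (4 * j + 3) * y))

/-- The hypergeometric term with base parameter `A`; `A = q⁻¹` recovers `termProd`. -/
def baseProd (q A y : L) (k : ℕ) : L := ∏ j ∈ range k, baseNum q A y j / baseDen q A y j

lemma baseProd_succ_mul (q A y : L) (k : ℕ) (h : baseDen q A y k ≠ 0) :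
    baseProd q A y (k + 1) * baseDen q A y k = baseProd q A y k * baseNum q A y k := by
  rw [baseProd, prod_range_succ, mul_assoc, div_mul_cancel₀ _ h]; rfl

lemma baseProd_shift (q A y : L) (k : ℕ) (h0 : 1 - A ≠ 0) (h0' : 1 - A * q ^ 2 ≠ 0)
    (h1 : ∀ j < k, 1 - q ^ (4 * j + 4) ≠ 0)
    (h2 : ∀ j ≤ k + 1, 1 - A * q ^ (2 * j + 3) ≠ 0)
    (h3 : ∀ j ≤ k, (1 - A * q ^ (4 * j + 3)) ^ 2 - A * q ^ (4 * j + 3) * y ≠ 0) :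
    baseProd q (A * q ^ 4) y k * ((1 - A * q ^ (2 * k + 3)) * ((1 - A * q ^ (2 * k + 5)) *
      ((1 - A * q ^ (4 * k + 3)) ^ 2 - A * q ^ (4 * k + 3) * y) * ((1 - A) * (1 - A * q ^ 2)))) =
    ((1 - A * q ^ (2 * k)) * (1 - A * q ^ (2 * k + 2)) * q ^ (4 * k) *
      (((1 - A * q ^ 3) ^ 2 - A * q ^ 3 * y) * (1 - A * q ^ 3) * (1 - A * q ^ 5))) *
      baseProd q A y k := by
  induction k with
  | zero => simp [baseProd]; ring
  | succ k ih =>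
    specialize ih (fun j hj => h1 j (by omega)) (fun j hj => h2 j (by omega))
      (fun j hj => h3 j (by omega))
    have hD : baseDen q A y k ≠ 0 :=
      mul_ne_zero (h1 k (by omega)) (mul_ne_zero (h2 k (by omega)) (h3 k (by omega)))
    have hD' : baseDen q (A * q ^ 4) y k ≠ 0 := by
      refine mul_ne_zero (h1 k (by omega)) (mul_ne_zero ?_ ?_)
      · convert h2 (k + 2) (by omega) using 1; ring
      · convert h3 (k + 1) (by omega) using 1; ring
    refine shift_step (baseProd_succ_mul q _ y k hD') (baseProd_succ_mul q A y k hD) ih hD' hD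
      (mul_ne_zero (h2 _ (by omega)) (mul_ne_zero (mul_ne_zero (h2 (k + 1) (by omega))
      (h3 _ (by omega))) (mul_ne_zero h0 h0'))) ?_
    unfold baseNum baseDen
    generalize (1 - q ^ (2 * k + 1)) ^ 2 - q ^ (2 * k + 1) * y = E
    generalize 1 - q ^ (4 * k + 4) = F
    generalize q - q ^ (4 * k) = E'
    generalize ((1 - A * q ^ 3) ^ 2 - A * q ^ 3 * y) * (1 - A * q ^ 3) * (1 - A * q ^ 5) = α
    generalize (1 - A) * (1 - A * q ^ 2) = β
    have e1 : (1 - A * q ^ (4 * (k + 1) + 3)) ^ 2 - A * q ^ (4 * (k + 1) + 3) * y =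
      ((1 - A * q ^ 4 * q ^ (4 * k + 3)) ^ 2 - A * q ^ 4 * q ^ (4 * k + 3) * y) := by ring
    rw [e1]
    generalize (1 - A * q ^ 4 * q ^ (4 * k + 3)) ^ 2 - A * q ^ 4 * q ^ (4 * k + 3) * y = W'
    generalize (1 - A * q ^ (4 * k + 3)) ^ 2 - A * q ^ (4 * k + 3) * y = W
    have e2 : q ^ (4 * k) = (q ^ (2 * k)) ^ 2 := by ring
    simp only [mul_add, mul_one, pow_add, e2]
    generalize q ^ (2 * k) = x
    ring

/-- Telescoping relation between the sums with base parameters `A` and `A q⁴`. -/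
lemma sum_base_shift (q A y : L) (K : ℕ) (h0 : 1 - A ≠ 0) (h0' : 1 - A * q ^ 2 ≠ 0)
    (h1 : ∀ j < K, 1 - q ^ (4 * j + 4) ≠ 0)
    (h2 : ∀ j ≤ K, 1 - A * q ^ (2 * j + 3) ≠ 0)
    (h3 : ∀ j < K, (1 - A * q ^ (4 * j + 3)) ^ 2 - A * q ^ (4 * j + 3) * y ≠ 0) :
    ∑ k ∈ range K, (((1 - A) * (1 - A * q ^ 2)) * ((1 - A * q ^ 4) ^ 2 - A * q ^ 4 * y) *
      (1 - A * q ^ 4 * q ^ (6 * k)) * baseProd q (A * q ^ 4) y k -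
      (((1 - A * q ^ 3) ^ 2 - A * q ^ 3 * y) * (1 - A * q ^ 3) * (1 - A * q ^ 5)) *
      (1 - A * q ^ (6 * k)) * baseProd q A y k) =
    baseProd q A y K * ((((1 - A * q ^ 3) ^ 2 - A * q ^ 3 * y) * (1 - A * q ^ 3) *
      (1 - A * q ^ 5)) * (1 - q ^ (4 * K)) * (1 - A ^ 2 * q ^ (4 * K + 3))) /
      (1 - A * q ^ (2 * K + 3)) := by
  induction K with
  | zero => simp
  | succ k ih =>
    have sh := baseProd_shift q A y k h0 h0' (fun j hj => h1 j (by omega))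
      (fun j hj => h2 j (by omega)) (fun j hj => h3 j (by omega))
    have hD : baseDen q A y k ≠ 0 :=
      mul_ne_zero (h1 k (by omega)) (mul_ne_zero (h2 k (by omega)) (h3 k (by omega)))
    rw [sum_range_succ, ih (fun j hj => h1 j (by omega)) (fun j hj => h2 j (by omega))
      (fun j hj => h3 j (by omega))]
    refine telescope_step (baseProd_succ_mul q A y k hD) sh hD (h2 _ (by omega))
      (mul_ne_zero (mul_ne_zero (h2 (k + 1) (by omega)) (h3 _ (by omega))) (mul_ne_zero h0 h0'))
      (h2 (k + 1) le_rfl) ?_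
    unfold baseNum baseDen
    generalize ((1 - A * q ^ 3) ^ 2 - A * q ^ 3 * y) * (1 - A * q ^ 3) * (1 - A * q ^ 5) = α
    generalize (1 - A) * (1 - A * q ^ 2) = β
    have e2 : q ^ (4 * k) = (q ^ (2 * k)) ^ 2 := by ring
    have e3 : q ^ (6 * k) = (q ^ (2 * k)) ^ 3 := by ring
    simp only [mul_add, mul_one, pow_add, e2, e3]
    generalize q ^ (2 * k) = x
    ring

lemma termProd_eq_zero (q y c : L) (hc : c ≠ 0) (h : c * (y + 2) = c ^ 2 + 1) {j k : ℕ}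
    (hj : c = q ^ (2 * j + 1)) (hk : j < k) : termProd q y k = 0 := by
  refine prod_eq_zero (mem_range.2 hk) ?_
  have : c * stepNum q y j = 0 := by rw [stepNum_mul q y c h, hj]; ring
  rw [(mul_eq_zero.1 this).resolve_left hc, zero_div]

lemma stepDen_ne_zero (q y : L) (hq : Function.Injective fun k : ℕ => q ^ k) {m : ℕ}
    (hm : m % 2 = 1) (h : q ^ m * (y + 2) = (q ^ m) ^ 2 + 1) (j : ℕ) : stepDen q y j ≠ 0 := by
  have hne : ∀ a b : ℕ, a ≠ b → q ^ a - q ^ b ≠ 0 := fun a b hab =>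
    sub_ne_zero.2 fun e => hab (hq e)
  refine right_ne_zero_of_mul (a := q ^ m) ?_
  rw [stepDen_mul q y _ h, ← pow_add, ← pow_zero q]
  exact mul_ne_zero (mul_ne_zero (hne _ _ (by omega)) (hne _ _ (by omega)))
    (mul_ne_zero (hne _ _ (by omega)) (hne _ _ (by omega)))

/-- Closed form of the deformed sum at `a = q ^ (4 * m + 1)`, where it terminates. -/
theorem sum_termProd_eval (q : L) (hq0 : q ≠ 0) (hq : Function.Injective fun k : ℕ => q ^ k)
    (m K : ℕ) (hK : 2 * m < K) (y : L)
    (h : q ^ (4 * m + 1) * (y + 2) = (q ^ (4 * m + 1)) ^ 2 + 1) :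
    (∏ i ∈ range m, (1 - q ^ (4 * i + 4))) * ∑ k ∈ range K, (q - q ^ (6 * k)) * termProd q y k =
      (q - 1) * ∏ i ∈ range m, (q * (1 - q ^ (4 * i + 2))) := by
  have hne : ∀ a b : ℕ, a ≠ b → q ^ a - q ^ b ≠ 0 := fun a b hab =>
    sub_ne_zero.2 fun e => hab (hq e)
  induction m generalizing K y with
  | zero =>
    rw [sum_eq_single_of_mem 0 (by simp; omega)]
    · simp [termProd]
    · intro k _ hk
      rw [termProd_eq_zero q y _ (pow_ne_zero _ hq0) h (j := 0) (by ring) (by omega), mul_zero]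
  | succ m ih =>
    set c := q ^ (4 * m + 1) with hc
    have hc0 : c ≠ 0 := pow_ne_zero _ hq0
    have hcc : q ^ (4 * (m + 1) + 1) = c * q ^ 4 := by rw [hc]; ring
    have hy : c * ((c + c⁻¹ - 2) + 2) = c ^ 2 + 1 := by field_simp; ring
    have key := sum_shift q (c + c⁻¹ - 2) y c hq0 hc0 hy (by rw [← hcc, h])
      (stepDen_ne_zero q _ hq (by omega) hy)
      (stepDen_ne_zero q _ hq (by omega) h)
      (fun j => by rw [hc, ← pow_add, ← pow_zero q]; exact hne _ _ (by omega))
      (fun j => by rw [hc, ← pow_add]; exact hne _ _ (by omega)) K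
    rw [termProd_eq_zero q y _ (pow_ne_zero _ hq0) h (j := 2 * (m + 1)) (by ring) hK] at key
    have ih' := ih K (by omega) _ hy
    rw [prod_range_succ, prod_range_succ]
    set S := ∑ k ∈ range K, (q - q ^ (6 * k)) * termProd q y k with hS
    set S' := ∑ k ∈ range K, (q - q ^ (6 * k)) * termProd q (c + c⁻¹ - 2) k with hS'
    have key' : q * (1 - q * c) * S' - (1 - c * q ^ 3) * S = 0 := by
      rw [hS, hS', mul_sum, mul_sum, ← sum_sub_distrib]
      simp only [zero_mul, zero_div] at key
      rw [← key]
      exact sum_congr rfl fun k _ => by ring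
    have e1 : q ^ (4 * m + 4) = c * q ^ 3 := by rw [hc]; ring
    have e2 : q ^ (4 * m + 2) = q * c := by rw [hc]; ring
    rw [e1, e2]
    linear_combination (q * (1 - q * c)) * ih' - (∏ i ∈ range m, (1 - q ^ (4 * i + 4))) * key'

/-- The sum vanishes when it terminates because of the base parameter `A`. -/
theorem sum_baseProd_eq_zero (q y : L) (i : ℕ) (A : L) (hA : A * q ^ (2 * (2 * i + 1)) = 1)
    (h1 : ∀ j < 2 * i + 1, 1 - q ^ (4 * j + 4) ≠ 0)
    (h2 : ∀ j ≤ 2 * i + 1, 1 - A * q ^ (2 * j + 3) ≠ 0)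
    (h3 : ∀ j < 2 * i + 1, (1 - A * q ^ (4 * j + 3)) ^ 2 - A * q ^ (4 * j + 3) * y ≠ 0)
    (h4 : ∀ j < 2 * i + 1, 1 - A * q ^ (2 * j) ≠ 0) :
    ∑ k ∈ range (2 * i + 2), (1 - A * q ^ (6 * k)) * baseProd q A y k = 0 := by
  induction i generalizing A with
  | zero =>
    have a1 := h1 0 (by omega)
    have a2 := h2 0 (by omega)
    have a3 := h3 0 (by omega)
    norm_num at hA a1 a2 a3
    have e3 : A * q ^ 3 = q := by linear_combination q * hA
    have e6 : A * q ^ 6 = q ^ 4 := by linear_combination q ^ 4 * hA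
    rw [e3] at a2 a3
    norm_num [sum_range_succ, baseProd, baseNum, baseDen, hA, e3, e6]
    field_simp
    ring
  | succ i ih =>
    have a0 : 1 - A ≠ 0 := by simpa using h4 0 (by omega)
    have a0' : 1 - A * q ^ 2 ≠ 0 := by simpa using h4 1 (by omega)
    have key := sum_base_shift q A y (2 * (i + 1) + 1) a0 a0' h1 h2 h3
    have hz := ih (A * q ^ 4) (by rw [← hA]; ring) (fun j hj => h1 j (by omega))
      (fun j hj => by convert h2 (j + 2) (by omega) using 1; ring)
      (fun j hj => by convert h3 (j + 1) (by omega) using 1; ring)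
      (fun j hj => by convert h4 (j + 2) (by omega) using 1; ring)
    have hlast : baseProd q (A * q ^ 4) y (2 * i + 2) = 0 := by
      refine prod_eq_zero (mem_range.2 (show 2 * i + 1 < _ by omega)) ?_
      have : 1 - A * q ^ 4 * q ^ (2 * (2 * i + 1)) = 0 := by
        rw [← hA]; ring
      rw [baseNum, this, zero_mul, zero_div]
    have hz' : ∑ k ∈ range (2 * (i + 1) + 1),
        (1 - A * q ^ 4 * q ^ (6 * k)) * baseProd q (A * q ^ 4) y k = 0 := by
      rw [show 2 * (i + 1) + 1 = 2 * i + 2 + 1 by ring, sum_range_succ, hz, hlast, mul_zero,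
        add_zero]
    rw [sum_sub_distrib] at key
    simp only [mul_assoc _ _ (baseProd _ _ _ _)] at key
    rw [← mul_sum, ← mul_sum, hz', mul_zero, zero_sub] at key
    rw [show 2 * (i + 1) + 2 = 2 * (i + 1) + 1 + 1 by ring, sum_range_succ]
    have b1 := h2 0 (by omega)
    have b2 := h2 1 (by omega)
    have b3 := h3 0 (by omega)
    have b4 := h2 _ le_rfl
    norm_num at b1 b2 b3
    generalize 2 * (i + 1) + 1 = N at *
    have e1 : A * q ^ (2 * N + 3) = q ^ 3 := by linear_combination q ^ 3 * hA
    have e2 : A ^ 2 * q ^ (4 * N + 3) = q ^ 3 := by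
      linear_combination (q ^ 3 * (A * q ^ (2 * N) + 1)) * hA
    have e3 : A * q ^ (6 * N) = q ^ (4 * N) := by linear_combination q ^ (4 * N) * hA
    rw [e1] at b4
    rw [e1, e2, ← mul_assoc (baseProd q A y N), mul_div_assoc, div_self b4] at key
    rw [e3]
    refine mul_left_cancel₀ (mul_ne_zero (mul_ne_zero b3 b1) b2) ?_
    linear_combination -key

lemma prod_range_odd {M : Type*} [CommMonoid M] (f : ℕ → M) (K : ℕ) :
    ∏ i ∈ range (2 * K + 1), f i =
      f 0 * ∏ j ∈ range K, (f (2 * j + 1) * f (2 * (j + 1))) := by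
  induction K with
  | zero => simp
  | succ K ih =>
    rw [show 2 * (K + 1) + 1 = 2 * K + 1 + 1 + 1 by ring, prod_range_succ, prod_range_succ, ih,
      prod_range_succ, mul_assoc, mul_assoc]
    rfl

lemma prod_neg_pow_odd (q : L) (K : ℕ) :
    ∏ j ∈ range K, (-q ^ (2 * j + 1)) = (-1) ^ K * q ^ K ^ 2 := by
  induction K with
  | zero => simp
  | succ K ih => rw [prod_range_succ, ih]; ring

lemma prod_odd_primitiveRoot {K : ℕ} {q : L} (hq : IsPrimitiveRoot q (2 * K + 1)) (a y : L)
    (h : a * (y + 2) = a ^ 2 + 1) :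
    (1 - a) * (a ^ K * ∏ j ∈ range K, ((1 - q ^ (2 * j + 1)) ^ 2 - q ^ (2 * j + 1) * y)) =
      (-1) ^ K * q ^ K ^ 2 * (1 - a ^ (2 * K + 1)) := by
  have h1 := congrArg (Polynomial.eval 1)
    (X_pow_sub_C_eq_prod hq (α := a) (a := a ^ (2 * K + 1)) (by omega) rfl)
  simp only [Polynomial.eval_sub, Polynomial.eval_pow, Polynomial.eval_X, Polynomial.eval_C,
    one_pow, Polynomial.eval_prod] at h1
  rw [h1, prod_range_odd, ← prod_neg_pow_odd, pow_zero, one_mul, ← card_range K, ← prod_const,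
    card_range, ← prod_mul_distrib, prod_mul_distrib (f := fun j => 1 - q ^ (2 * j + 1) * a),
    ← prod_range_reflect (fun j => 1 - q ^ (2 * (j + 1)) * a), ← prod_mul_distrib,
    mul_left_comm, ← prod_mul_distrib]
  congr 1
  refine prod_congr rfl fun j hj => ?_
  have hj' := mem_range.1 hj
  obtain ⟨t, rfl⟩ := Nat.exists_eq_add_of_lt hj'
  rw [show j + t + 1 - 1 - j + 1 = t + 1 by omega]
  have e : q ^ (2 * j + 1) * q ^ (2 * (t + 1)) = 1 := by
    rw [← pow_add, ← hq.pow_eq_one]; congr 1; ring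
  linear_combination (-q ^ (2 * j + 1)) * h - (a * (1 - q ^ (2 * j + 1) * a)) * e

end TermProd

section Cleared

/-- The deformed sum minus its expected value, with all denominators cleared. -/
def clearedSum {R : Type*} [CommRing R] (M : ℕ) (q y : R) : R :=
  (∏ i ∈ range M, (1 - q ^ (4 * i + 4))) * ∑ k ∈ range (2 * M + 1), (q - q ^ (6 * k)) *
      ((∏ j ∈ range k, stepNum q y j) * ∏ j ∈ Ico k (2 * M), stepDen q y j) +
    (1 - q) * (∏ i ∈ range M, (q * (1 - q ^ (4 * i + 2)))) * ∏ j ∈ range (2 * M), stepDen q y j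

lemma map_stepNum {R S : Type*} [CommRing R] [CommRing S] (f : R →+* S) (q y : R) (j : ℕ) :
    f (stepNum q y j) = stepNum (f q) (f y) j := by
  simp [stepNum]

lemma map_stepDen {R S : Type*} [CommRing R] [CommRing S] (f : R →+* S) (q y : R) (j : ℕ) :
    f (stepDen q y j) = stepDen (f q) (f y) j := by
  simp [stepDen]

lemma map_clearedSum {R S : Type*} [CommRing R] [CommRing S] (f : R →+* S) (M : ℕ) (q y : R) :
    f (clearedSum M q y) = clearedSum M (f q) (f y) := by
  simp [clearedSum, map_stepNum, map_stepDen]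

lemma clearedSum_eq {L : Type*} [Field L] (M : ℕ) (q y : L)
    (h : ∀ j < 2 * M, stepDen q y j ≠ 0) :
    clearedSum M q y = (∏ j ∈ range (2 * M), stepDen q y j) *
      ((∏ i ∈ range M, (1 - q ^ (4 * i + 4))) *
        (∑ k ∈ range (2 * M + 1), (q - q ^ (6 * k)) * termProd q y k) +
      (1 - q) * ∏ i ∈ range M, (q * (1 - q ^ (4 * i + 2)))) := by
  have key : ∀ k ∈ range (2 * M + 1), (q - q ^ (6 * k)) *
      ((∏ j ∈ range k, stepNum q y j) * ∏ j ∈ Ico k (2 * M), stepDen q y j) =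
      (∏ j ∈ range (2 * M), stepDen q y j) * ((q - q ^ (6 * k)) * termProd q y k) := by
    intro k hk
    have hk' : k ≤ 2 * M := Nat.lt_succ_iff.1 (mem_range.1 hk)
    have h0 : ∏ j ∈ range k, stepDen q y j ≠ 0 :=
      prod_ne_zero_iff.2 fun j hj => h j (by have := mem_range.1 hj; omega)
    rw [← prod_range_mul_prod_Ico _ hk', termProd, prod_div_distrib]
    field_simp
  rw [clearedSum, sum_congr rfl key, ← mul_sum]
  ring

lemma clearedSum_eq_zero {L : Type*} [Field L] (q : L) (hq0 : q ≠ 0)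
    (hq : Function.Injective fun k : ℕ => q ^ k) (M : ℕ) (y : L)
    (h : q ^ (4 * M + 1) * (y + 2) = (q ^ (4 * M + 1)) ^ 2 + 1) : clearedSum M q y = 0 := by
  rw [clearedSum_eq M q y fun j _ => stepDen_ne_zero q y hq (by omega) h j,
    sum_termProd_eval q hq0 hq M _ (by omega) y h]
  ring

lemma baseNum_inv {L : Type*} [Field L] (q y : L) (hq : q ≠ 0) (j : ℕ) :
    baseNum q q⁻¹ y j = stepNum q y j := by
  unfold baseNum stepNum
  field_simp
  ring

lemma baseDen_inv {L : Type*} [Field L] (q y : L) (hq : q ≠ 0) (j : ℕ) :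
    baseDen q q⁻¹ y j = stepDen q y j := by
  have e1 : q⁻¹ * q ^ (2 * j + 3) = q ^ (2 * j + 2) := by field_simp; ring
  have e2 : q⁻¹ * q ^ (4 * j + 3) = q ^ (4 * j + 2) := by field_simp; ring
  rw [baseDen, stepDen, e1, e2]
  ring

lemma termProd_const {M : ℕ} {q : ℂ} (hq : IsPrimitiveRoot q (4 * M + 1)) :
    ∃ κ : ℂ, ∀ y, y ≠ 0 →
      (∀ j < 2 * M, (1 - q ^ (4 * j + 2)) ^ 2 - q ^ (4 * j + 2) * y ≠ 0) →
      termProd q y (2 * M + 1) = κ := by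
  have hq0 : q ≠ 0 := hq.ne_zero (by omega)
  refine ⟨(∏ j ∈ range (2 * M + 1), ((q - q ^ (2 * j)) * (q - q ^ (4 * j)) * q ^ (2 * j) /
    ((1 - q ^ (2 * j + 2)) * (1 - q ^ (4 * j + 4))))) * (q ^ (2 * M) ^ 2)⁻¹, fun y hy h => ?_⟩
  simp only [termProd, stepNum, stepDen, mul_div_mul_comm _ ((1 - q ^ (2 * _ + 1)) ^ 2 - _)]
  rw [prod_mul_distrib]
  congr 1
  have e1 : q ^ (2 * (2 * M) + 1) = 1 := by rw [← hq.pow_eq_one]; congr 1; ring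
  have e2 : q ^ (4 * (2 * M) + 2) = 1 := by
    rw [← one_pow 2, ← hq.pow_eq_one, ← pow_mul]; congr 1; ring
  rw [prod_range_succ, e1, e2, div_self (by simpa using hy), mul_one, prod_div_distrib]
  obtain ⟨a, ha⟩ : ∃ a : ℂ, a * (y + 2) = a ^ 2 + 1 := by
    obtain ⟨s, hs⟩ := IsAlgClosed.exists_pow_nat_eq ((y + 2) ^ 2 - 4) (n := 2) (by norm_num)
    exact ⟨((y + 2) + s) / 2, by linear_combination (-1 / 4) * hs⟩
  have ha0 : a ≠ 0 := by rintro rfl; simp at ha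
  have ha1 : 1 - a ≠ 0 := by
    intro e
    obtain rfl : a = 1 := by linear_combination -e
    exact hy (by linear_combination ha)
  have hK : 4 * M + 1 = 2 * (2 * M) + 1 := by ring
  rw [hK] at hq
  have p1 := prod_odd_primitiveRoot hq a y ha
  have p2 := prod_odd_primitiveRoot (hq.pow_of_coprime 2 (by simp)) a y ha
  simp only [← pow_mul, show ∀ j, 2 * (2 * j + 1) = 4 * j + 2 by intro j; ring] at p2
  have h0 : ∏ j ∈ range (2 * M), ((1 - q ^ (4 * j + 2)) ^ 2 - q ^ (4 * j + 2) * y) ≠ 0 :=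
    prod_ne_zero_iff.2 fun j hj => h j (mem_range.1 hj)
  rw [eq_comm, inv_eq_iff_eq_inv, inv_div, eq_div_iff]
  · refine mul_left_cancel₀ (mul_ne_zero ha1 (pow_ne_zero (2 * M) ha0)) ?_
    linear_combination q ^ (2 * M) ^ 2 * p1 - p2
  · intro e
    rw [e, mul_zero, mul_zero, eq_comm] at p1
    have : 1 - a ^ (2 * (2 * M) + 1) = 0 := by
      simpa [hq0] using p1
    rw [this, mul_zero] at p2
    exact mul_ne_zero ha1 (mul_ne_zero (pow_ne_zero _ ha0) h0) p2

lemma one_sub_pow_ne_zero {M : ℕ} {q : ℂ} (hq : IsPrimitiveRoot q (4 * M + 1)) {e : ℕ}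
    (he : ¬ (4 * M + 1) ∣ e) : 1 - q ^ e ≠ 0 := fun h =>
  he ((hq.pow_eq_one_iff_dvd e).1 (by linear_combination -h))

/-- At a primitive root of unity the cleared sum depends on `y` only through its denominators. -/
lemma clearedSum_primitiveRoot {M : ℕ} (hM : 0 < M) {q : ℂ} (hq : IsPrimitiveRoot q (4 * M + 1)) :
    ∃ κ : ℂ, ∀ y, y ≠ 0 →
      (∀ j < 2 * M + 1, (1 - q ^ (4 * j + 2)) ^ 2 - q ^ (4 * j + 2) * y ≠ 0) →
      clearedSum M q y = κ * ∏ j ∈ range (2 * M), stepDen q y j := by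
  obtain ⟨κ, hκ⟩ := termProd_const hq
  have hq0 : q ≠ 0 := hq.ne_zero (by omega)
  have n1 : ∀ j < 2 * M + 1, 1 - q ^ (4 * j + 4) ≠ 0 := fun j hj =>
    one_sub_pow_ne_zero hq fun hd => by
      have : (4 * M + 1) ∣ j + 1 := by
        refine Nat.Coprime.dvd_of_dvd_mul_left (k := 4 * M + 1) (n := j + 1) (m := 4) ?_ hd
        simp
      have := Nat.le_of_dvd (by omega) this
      omega
  have n2 : ∀ j ≤ 2 * M + 1, 1 - q ^ (2 * j + 2) ≠ 0 := fun j hj =>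
    one_sub_pow_ne_zero hq fun hd => by
      have : (4 * M + 1) ∣ j + 1 := by
        refine Nat.Coprime.dvd_of_dvd_mul_left (k := 4 * M + 1) (n := j + 1) (m := 2) ?_ hd
        simp [show 4 * M = 2 * (2 * M) by ring]
      have := Nat.le_of_dvd (by omega) this
      omega
  refine ⟨(∏ i ∈ range M, (1 - q ^ (4 * i + 4))) * (-((q - q ^ (6 * (2 * M + 1))) * κ)) +
      (1 - q) * ∏ i ∈ range M, (q * (1 - q ^ (4 * i + 2))), fun y hy h => ?_⟩
  have e2 : ∀ j, q⁻¹ * q ^ (4 * j + 3) = q ^ (4 * j + 2) := fun j => by field_simp; ring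
  have hz := sum_baseProd_eq_zero q y M q⁻¹
    (by
      rw [show 2 * (2 * M + 1) = 4 * M + 1 + 1 by ring, pow_succ, hq.pow_eq_one, one_mul,
        inv_mul_cancel₀ hq0]) n1
    (fun j hj => by
      rw [show q⁻¹ * q ^ (2 * j + 3) = q ^ (2 * j + 2) by field_simp; ring]
      exact n2 j hj)
    (fun j hj => by rw [e2]; exact h j hj)
    (fun j hj => by
      rcases j with _ | j
      · have := one_sub_pow_ne_zero hq (e := 1) (fun hd => by have := Nat.le_of_dvd one_pos hd; omega)
        intro e
        apply this
        field_simp at e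
        linear_combination -e
      · rw [show q⁻¹ * q ^ (2 * (j + 1)) = q ^ (2 * j + 1) by field_simp; ring]
        exact one_sub_pow_ne_zero hq fun hd => by
          have := Nat.le_of_dvd (by omega) hd
          omega)
  rw [clearedSum_eq M q y fun j hj => mul_ne_zero (mul_ne_zero (n2 j (by omega))
    (n1 j (by omega))) (h j (by omega)), mul_comm (_ + _ : ℂ) (∏ j ∈ _, _)]
  congr 3
  have hb : ∀ k, baseProd q q⁻¹ y k = termProd q y k := fun k => by
    simp only [baseProd, termProd, baseNum_inv q y hq0, baseDen_inv q y hq0]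
  simp only [hb] at hz
  have hz' := congrArg (q * ·) hz
  simp only [mul_sum, mul_zero] at hz'
  rw [sum_range_succ, hκ y hy fun j hj => h j (by omega)] at hz'
  rw [eq_neg_iff_add_eq_zero, ← hz']
  congr 1
  · exact sum_congr rfl fun k _ => by field_simp
  · field_simp

end Cleared

section Divisibility
open Polynomial

/-- If a polynomial over `ℚ[q]` vanishes at the fraction `r / s`, then `r` divides
its constant coefficient times a power of `s`. -/
lemma dvd_coeff_zero_of_aeval_div {p : Polynomial R1} {r s : R1} (hs : s ≠ 0)
    (h : aeval (algebraMap R1 K1 r / algebraMap R1 K1 s) p = 0) :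
    r ∣ p.coeff 0 * s ^ p.natDegree := by
  have h1 := scaleRoots_aeval_eq_zero_of_aeval_div_eq_zero
    (FaithfulSMul.algebraMap_injective R1 K1) h (mem_nonZeroDivisors_of_ne_zero hs)
  rw [aeval_algebraMap_apply, map_eq_zero_iff _ (FaithfulSMul.algebraMap_injective R1 K1),
    coe_aeval_eq_eval] at h1
  have h2 := sub_dvd_eval_sub r 0 (p.scaleRoots s)
  rw [h1, ← coeff_zero_eq_eval_zero, coeff_scaleRoots] at h2
  simpa using h2

lemma qv_ne_zero : qv ≠ 0 := by
  simp [qv]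

lemma qv_pow_injective : Function.Injective fun k : ℕ => qv ^ k := by
  intro a b h
  simp only [qv, ← map_pow] at h
  simpa using congrArg natDegree (FaithfulSMul.algebraMap_injective R1 K1 h)

lemma stepDen_primitiveRoot_ne_zero {M : ℕ} {ζ : ℂ} (hζ : IsPrimitiveRoot ζ (4 * M + 1)) {j : ℕ}
    (hj : j < 2 * M) : stepDen ζ 0 j ≠ 0 := by
  have hd : ∀ c, Nat.Coprime (4 * M + 1) c → ∀ i, 0 < i → i < 4 * M + 1 → 1 - ζ ^ (c * i) ≠ 0 :=
    fun c hc i hi hi' => one_sub_pow_ne_zero hζ fun h =>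
      absurd (Nat.le_of_dvd hi (hc.dvd_of_dvd_mul_left h)) (by omega)
  have h2 : Nat.Coprime (4 * M + 1) 2 := by simp [show 4 * M = 2 * (2 * M) by ring]
  have a := hd 2 h2 (j + 1) (by omega) (by omega)
  have b := hd 4 (by simp) (j + 1) (by omega) (by omega)
  have c := hd 2 h2 (2 * j + 1) (by omega) (by omega)
  rw [stepDen, mul_zero, sub_zero]
  exact mul_ne_zero (mul_ne_zero (by convert a using 3; ring) (by convert b using 3; ring))
    (pow_ne_zero 2 (by convert c using 3; ring))

lemma cyclotomic_dvd_iff {n : ℕ} (hn : 0 < n) {ζ : ℂ} (hζ : IsPrimitiveRoot ζ n) (p : R1) :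
    cyclotomic n ℚ ∣ p ↔ aeval ζ p = 0 := by
  rw [cyclotomic_eq_minpoly_rat hζ hn]
  exact minpoly.dvd_iff

lemma cyclotomic_pow_dvd_of_mul_X_pow {n : ℕ} {p : R1} {k e : ℕ}
    (h : cyclotomic n ℚ ^ k ∣ p * (X ^ n) ^ e) : cyclotomic n ℚ ^ k ∣ p := by
  have hc : IsCoprime (X ^ n : R1) (X ^ n - 1) := ⟨1, -1, by ring⟩
  exact ((hc.pow_left (m := e)).symm.of_isCoprime_of_dvd_left
    (cyclotomic.dvd_X_pow_sub_one n ℚ)).pow_left.dvd_of_dvd_mul_right h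

lemma cyclotomic_cube_dvd_clearedSum {M : ℕ} (hM : 0 < M) :
    cyclotomic (4 * M + 1) ℚ ^ 3 ∣ clearedSum M (X : R1) 0 := by
  have hn : 0 < 4 * M + 1 := by omega
  set n := 4 * M + 1 with hndef
  obtain ⟨ζ, hζ⟩ : ∃ ζ : ℂ, IsPrimitiveRoot ζ n := ⟨_, Complex.isPrimitiveRoot_exp n hn.ne'⟩
  set H : Polynomial R1 := clearedSum M (C X) X with hH
  have hH0 : H.coeff 0 = clearedSum M X 0 := by
    rw [coeff_zero_eq_eval_zero, ← coe_evalRingHom, hH, map_clearedSum]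
    simp
  set y : K1 := algebraMap R1 K1 ((1 - X ^ n) ^ 2) / algebraMap R1 K1 (X ^ n) with hy
  have hXn : algebraMap R1 K1 (X ^ n) ≠ 0 := by simp
  have hroot : aeval y H = 0 := by
    have : aeval y H = clearedSum M qv y := by
      have := map_clearedSum (aeval (R := R1) y : Polynomial R1 →ₐ[R1] K1).toRingHom M (C X) X
      simpa [qv] using this
    rw [this]
    refine clearedSum_eq_zero qv qv_ne_zero qv_pow_injective M y ?_
    have e : qv ^ n = algebraMap R1 K1 (X ^ n) := by simp [qv]
    rw [← hndef, e, hy, mul_add, mul_div_cancel₀ _ hXn]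
    simp only [map_pow, map_sub, map_one]
    ring
  have hΦ : cyclotomic n ℚ ∣ X ^ n - 1 := cyclotomic.dvd_X_pow_sub_one n ℚ
  have hΦ2 : cyclotomic n ℚ ^ 2 ∣ (1 - X ^ n) ^ 2 := by
    rw [← neg_sub, neg_sq]; exact pow_dvd_pow_of_dvd hΦ 2
  have hdvd : ∀ p : Polynomial R1, aeval y p = 0 → cyclotomic n ℚ ^ 2 ∣ p.coeff 0 := fun p hp =>
    cyclotomic_pow_dvd_of_mul_X_pow
      (hΦ2.trans (dvd_coeff_zero_of_aeval_div (pow_ne_zero n X_ne_zero) hp))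
  have hzero : clearedSum M ζ 0 = 0 := by
    have h1 := (cyclotomic_dvd_iff hn hζ _).1 ((dvd_pow_self _ two_ne_zero).trans (hdvd H hroot))
    have h2 := map_clearedSum (aeval ζ : R1 →ₐ[ℚ] ℂ).toRingHom M X 0
    rw [hH0] at h1
    simpa [h1] using h2.symm
  have hmap : H.map (aeval ζ : R1 →ₐ[ℚ] ℂ).toRingHom = clearedSum M (C ζ) X := by
    have := map_clearedSum (mapRingHom (aeval ζ : R1 →ₐ[ℚ] ℂ).toRingHom) M (C X) X
    simpa using this
  have heval : ∀ z, (clearedSum M (C ζ) X : ℂ[X]).eval z = clearedSum M ζ z := fun z => by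
    have := map_clearedSum (evalRingHom z) M (C ζ) X
    simpa using this
  have hden : ∀ z, (∏ j ∈ range (2 * M), stepDen (C ζ) X j : ℂ[X]).eval z =
      ∏ j ∈ range (2 * M), stepDen ζ z j := fun z => by
    rw [← coe_evalRingHom, map_prod]
    exact prod_congr rfl fun j _ => by
      have := map_stepDen (evalRingHom z) (C ζ) X j
      simpa using this
  obtain ⟨κ, hκ⟩ := clearedSum_primitiveRoot hM hζ
  have hζ0 : ζ ≠ 0 := hζ.ne_zero hn.ne'
  have hpoly : (clearedSum M (C ζ) X : ℂ[X]) = C κ * ∏ j ∈ range (2 * M), stepDen (C ζ) X j := by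
    refine eq_of_infinite_eval_eq _ _ (Set.Infinite.mono ?_ (Set.Finite.infinite_compl
      ((insert 0 ((range (2 * M + 1)).image
        fun j => (1 - ζ ^ (4 * j + 2)) ^ 2 / ζ ^ (4 * j + 2)) : Finset ℂ).finite_toSet)))
    intro z hz
    simp only [coe_insert, coe_image, Set.mem_compl_iff, Set.mem_insert_iff, not_or,
      Set.mem_image, mem_coe, mem_range, not_exists, not_and] at hz
    rw [Set.mem_ofPred_eq, heval, eval_mul, eval_C, hden]
    refine hκ z hz.1 fun j hj e => hz.2 j hj ?_
    rw [div_eq_iff (pow_ne_zero _ hζ0)]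
    linear_combination e
  have hκ0 : κ = 0 := by
    have h := heval 0
    rw [hpoly, eval_mul, eval_C, hden, hzero] at h
    exact (mul_eq_zero.1 h).resolve_right
      (prod_ne_zero_iff.2 fun j hj => stepDen_primitiveRoot_ne_zero hζ (mem_range.1 hj))
  rw [hκ0, C_0, zero_mul] at hpoly
  obtain ⟨H', hH'⟩ : C (cyclotomic n ℚ) ∣ H := by
    refine (C_dvd_iff_dvd_coeff _ _).2 fun i => (cyclotomic_dvd_iff hn hζ _).2 ?_
    have := congrArg (fun p => coeff p i) (hmap.trans hpoly)
    simpa using this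
  have hH'0 : aeval y H' = 0 := by
    rw [hH', map_mul, aeval_C] at hroot
    exact (mul_eq_zero.1 hroot).resolve_left ((map_ne_zero_iff _
      (FaithfulSMul.algebraMap_injective R1 K1)).2 (cyclotomic_ne_zero n ℚ))
  rw [← hH0, hH', coeff_C_mul, pow_succ']
  exact mul_dvd_mul_left _ (hdvd H' hH'0)

end Divisibility

section Summand

lemma stepNum_zero {L : Type*} [Field L] {q : L} (hq : q ≠ 0) (j : ℕ) :
    stepNum q 0 j = q ^ (2 * j + 2) * ((1 - q⁻¹ * (q ^ 4) ^ j) * (1 - q⁻¹ * (q ^ 2) ^ j) *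
      (1 - q * (q ^ 2) ^ j) ^ 2) := by
  rw [stepNum, ← pow_mul, ← pow_mul]
  field_simp
  ring

lemma prod_stepNum_zero {L : Type*} [Field L] {q : L} (hq : q ≠ 0) (k : ℕ) :
    ∏ j ∈ range k, stepNum q 0 j = q ^ (k ^ 2 + k) *
      (qPoch q⁻¹ (q ^ 4) k * qPoch q⁻¹ (q ^ 2) k * qPoch q (q ^ 2) k ^ 2) := by
  have h : ∏ j ∈ range k, q ^ (2 * j + 2) = q ^ (k ^ 2 + k) := by
    induction k with
    | zero => simp
    | succ k ih => rw [prod_range_succ, ih, ← pow_add]; congr 1; ring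
  simp only [stepNum_zero hq, prod_mul_distrib, prod_pow, h, qPoch]

lemma prod_stepDen_zero {R : Type*} [CommRing R] (q : R) (k : ℕ) :
    ∏ j ∈ range k, stepDen q 0 j =
      qPoch (q ^ 2) (q ^ 2) k * qPoch (q ^ 4) (q ^ 4) k * qPoch (q ^ 2) (q ^ 4) k ^ 2 := by
  simp only [qPoch, ← prod_pow, ← prod_mul_distrib]
  exact prod_congr rfl fun j _ => by rw [stepDen]; ring

lemma summand_eq {L : Type*} [Field L] {q : L} (hq : q ≠ 0) (k : ℕ) :
    qInt q (6 * (k : ℤ) - 1) *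
        (qPoch (q ^ (-1 : ℤ)) (q ^ 4) k * qPoch (q ^ (-1 : ℤ)) (q ^ 2) k * qPoch q (q ^ 2) k ^ 2) /
        (qPoch (q ^ 2) (q ^ 2) k * qPoch (q ^ 4) (q ^ 4) k * qPoch (q ^ 2) (q ^ 4) k ^ 2) *
        q ^ (k ^ 2 + k + 1) = (q - q ^ (6 * k)) * termProd q 0 k / (1 - q) := by
  have h : (1 - q ^ (6 * (k : ℤ) - 1)) * q = q - q ^ (6 * k) := by
    rw [sub_mul, ← zpow_add_one₀ hq, one_mul, sub_add_cancel]
    norm_cast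
  rw [termProd, prod_div_distrib, prod_stepNum_zero hq, prod_stepDen_zero, ← h, qInt,
    zpow_neg_one, pow_succ]
  ring

end Summand

/-- Theorem 1.3, first case: for `n ≡ 1 (mod 4)`,
`Σ_{k=0}^{(n-1)/2} [6k-1] (q^{-1};q^4)_k (q^{-1};q^2)_k (q;q^2)_k² /
((q^2;q^2)_k (q^4;q^4)_k (q^2;q^4)_k²) q^{k²+k+1}
≡ -(q^2;q^4)_{(n-1)/4}/(q^4;q^4)_{(n-1)/4} · q^{(n-1)/4} (mod Φ_n(q)^3)`. -/
theorem stmt6 (n : ℕ) (hn : 0 < n) (hmod : n % 4 = 1) :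
    CongrMod1
      (∑ k ∈ Finset.range ((n - 1) / 2 + 1),
        qInt qv (6 * (k : ℤ) - 1) *
          (qPoch (qv ^ (-1 : ℤ)) (qv ^ 4) k * qPoch (qv ^ (-1 : ℤ)) (qv ^ 2) k *
            qPoch qv (qv ^ 2) k ^ 2) /
          (qPoch (qv ^ 2) (qv ^ 2) k * qPoch (qv ^ 4) (qv ^ 4) k *
            qPoch (qv ^ 2) (qv ^ 4) k ^ 2) *
          qv ^ (k ^ 2 + k + 1))
      (-(qPoch (qv ^ 2) (qv ^ 4) ((n - 1) / 4) / qPoch (qv ^ 4) (qv ^ 4) ((n - 1) / 4)) *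
        qv ^ ((n - 1) / 4))
      (Polynomial.cyclotomic n ℚ ^ 3) := by
  obtain ⟨M, rfl⟩ : ∃ M, n = 4 * M + 1 := ⟨n / 4, by omega⟩
  rw [show (4 * M + 1 - 1) / 2 = 2 * M by omega, show (4 * M + 1 - 1) / 4 = M by omega]
  have hpow : ∀ m : ℕ, 0 < m → 1 - qv ^ m ≠ 0 := fun m hm => sub_ne_zero.2 fun e =>
    hm.ne (qv_pow_injective (by simpa using e))
  have h1 : 1 - qv ≠ 0 := by simpa using hpow 1 one_pos
  have hE : qPoch (qv ^ 4) (qv ^ 4) M = ∏ i ∈ range M, (1 - qv ^ (4 * i + 4)) :=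
    prod_congr rfl fun i _ => by ring
  have hR : qPoch (qv ^ 2) (qv ^ 4) M * qv ^ M = ∏ i ∈ range M, (qv * (1 - qv ^ (4 * i + 2))) := by
    rw [prod_mul_distrib, prod_const, card_range, mul_comm]
    congr 1
    exact prod_congr rfl fun i _ => by ring
  have hE0 : ∏ i ∈ range M, (1 - qv ^ (4 * i + 4)) ≠ 0 :=
    prod_ne_zero_iff.2 fun i _ => hpow _ (by omega)
  have hD : ∀ j, stepDen qv 0 j ≠ 0 := fun j => by
    rw [stepDen, mul_zero, sub_zero]
    exact mul_ne_zero (mul_ne_zero (hpow _ (by omega)) (hpow _ (by omega)))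
      (pow_ne_zero 2 (hpow _ (by omega)))
  simp only [summand_eq qv_ne_zero]
  rw [← sum_div, neg_mul, div_mul_eq_mul_div, hR, hE]
  rcases Nat.eq_zero_or_pos M with rfl | hM
  · refine ⟨0, 1, one_ne_zero, fun p hp h => absurd (isUnit_of_dvd_one h) hp.not_isUnit, ?_⟩
    have : (qv - 1) / (1 - qv) + 1 = 0 := by field_simp; ring
    simpa [termProd] using this
  have hn' : 0 < 4 * M + 1 := by omega
  obtain ⟨ζ, hζ⟩ : ∃ ζ : ℂ, IsPrimitiveRoot ζ (4 * M + 1) :=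
    ⟨_, Complex.isPrimitiveRoot_exp _ hn'.ne'⟩
  obtain ⟨f, hf⟩ := cyclotomic_cube_dvd_clearedSum hM
  set g : R1 := (1 - Polynomial.X) * (∏ i ∈ range M, (1 - Polynomial.X ^ (4 * i + 4))) *
    ∏ j ∈ range (2 * M), stepDen Polynomial.X 0 j with hg
  have hgζ : Polynomial.aeval ζ g ≠ 0 := by
    have hs : ∀ j, Polynomial.aeval ζ (stepDen Polynomial.X 0 j : R1) = stepDen ζ 0 j := fun j => by
      have := map_stepDen (Polynomial.aeval ζ : R1 →ₐ[ℚ] ℂ).toRingHom Polynomial.X 0 j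
      simpa using this
    simp only [hg, map_mul, map_prod, map_sub, map_one, map_pow, Polynomial.aeval_X, hs]
    refine mul_ne_zero (mul_ne_zero ?_ (prod_ne_zero_iff.2 fun i hi => ?_))
      (prod_ne_zero_iff.2 fun j hj => stepDen_primitiveRoot_ne_zero hζ (mem_range.1 hj))
    · simpa using one_sub_pow_ne_zero hζ (e := 1) fun h => by
        have := Nat.le_of_dvd one_pos h
        omega
    · have hi := mem_range.1 hi
      exact one_sub_pow_ne_zero hζ fun h => by
        have := Nat.le_of_dvd (by omega) h
        omega
  have hcop : IsCoprime g (Polynomial.cyclotomic (4 * M + 1) ℚ ^ 3) :=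
    (((Polynomial.cyclotomic.irreducible_rat hn').coprime_iff_not_dvd.2 fun h =>
      hgζ ((cyclotomic_dvd_iff hn' hζ g).1 h)).symm).pow_right
  refine ⟨f, g, fun h => hgζ (by rw [h, map_zero]), fun p hp h h' =>
    hp.not_isUnit (hcop.isUnit_of_dvd' h h'), ?_⟩
  have hgK : algebraMap R1 K1 g = (1 - qv) * (∏ i ∈ range M, (1 - qv ^ (4 * i + 4))) *
      ∏ j ∈ range (2 * M), stepDen qv 0 j := by
    simp only [hg, map_mul, map_prod, map_sub, map_one, map_pow, map_stepDen, map_zero, qv]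
  rw [← map_mul, ← hf, map_clearedSum, map_zero, hgK]
  change _ = clearedSum M qv 0
  rw [clearedSum_eq M qv 0 fun j _ => hD j]
  field_simp
  ring

end
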